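/- Proposition (GBDT for Shin-Zettl systems): let y(x,λ) satisfy the Shin-Zettl system y′ = F(x,λ)y with F(x,λ) = [[r₁(x), p(x)⁻¹],[q(x) − λω(x), r₂(x)]], and let the GBDT data Π₁, Π₂, S, w_A be constructed (with m = 2, Q₁ = [[0,0],[ω,0]], Q₀ = −[[r₁, p⁻¹],[q, r₂]]) from matrices A₁, A₂, S(0), Π₁(0), Π₂(0) with A₁S(0) − S(0)A₂ = Π₁(0)Π₂(0)*. Then ỹ(x,λ) := w_A(x,λ)y(x,λ) satisfies, at points where S(x) and (A₁ − λI_n) are invertible, the transformed Shin-Zettl system ỹ′ = F̃(x,λ)ỹ with F̃(x,λ) = [[r̃₁(x), p(x)⁻¹],[q̃(x) − λω(x), r̃₂(x)]], where r̃₁ = r₁ − ωX₁₂, r̃₂ = r₂ + ωX₁₂, q̃ = q + ω(X₁₁ − X₂₂), and X_{ik}(x) are the entries of X(x) = Π₂(x)*S(x)⁻¹Π₁(x); in particular the weight ω and the coefficient p⁻¹ are unchanged. -/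

import Mathlib

open Matrix Set

attribute [local instance] Matrix.normedAddCommGroup Matrix.normedSpace

section MatrixDeriv

variable {l m n : Type*} [Fintype m] [Fintype n] {x : ℝ}

theorem Matrix.hasDerivAt_iff_entries [Fintype l] {f : ℝ → Matrix l m ℂ} {f' : Matrix l m ℂ} :
    HasDerivAt f f' x ↔ ∀ i j, HasDerivAt (fun t => f t i j) (f' i j) x :=
  hasDerivAt_pi.trans (forall_congr' fun _ => hasDerivAt_pi)

theorem HasDerivAt.matrix_mul [Fintype l] {f : ℝ → Matrix l m ℂ} {g : ℝ → Matrix m n ℂ}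
    {f' : Matrix l m ℂ} {g' : Matrix m n ℂ}
    (hf : HasDerivAt f f' x) (hg : HasDerivAt g g' x) :
    HasDerivAt (fun t => f t * g t) (f' * g x + f x * g') x := by
  rw [hasDerivAt_iff_entries] at hf hg ⊢
  intro i j
  simp only [Matrix.add_apply, Matrix.mul_apply, ← Finset.sum_add_distrib]
  exact HasDerivAt.fun_sum fun k _ => (hf i k).mul (hg k j)

theorem HasDerivAt.matrix_mulVec [Fintype l] {f : ℝ → Matrix l m ℂ} {g : ℝ → m → ℂ}
    {f' : Matrix l m ℂ} {g' : m → ℂ}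
    (hf : HasDerivAt f f' x) (hg : HasDerivAt g g' x) :
    HasDerivAt (fun t => f t *ᵥ g t) (f' *ᵥ g x + f x *ᵥ g') x := by
  rw [hasDerivAt_iff_entries] at hf
  rw [hasDerivAt_pi] at hg ⊢
  intro i
  simp only [Pi.add_apply, Matrix.mulVec, dotProduct, ← Finset.sum_add_distrib]
  exact HasDerivAt.fun_sum fun k _ => (hf i k).mul (hg k)

theorem HasDerivAt.ringInverse {R : Type*} [NormedRing R] [NormedAlgebra ℝ R] [CompleteSpace R]
    {f : ℝ → R} {f' : R} (hf : HasDerivAt f f' x) (hx : IsUnit (f x)) :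
    HasDerivAt (fun t => Ring.inverse (f t))
      (-(Ring.inverse (f x) * f' * Ring.inverse (f x))) x := by
  obtain ⟨u, hu⟩ := hx
  have h := (hasFDerivAt_ringInverse (𝕜 := ℝ) u).comp_hasDerivAt_of_eq x hf hu
  simpa [← hu, Function.comp_def] using h

theorem HasDerivAt.matrix_inv [DecidableEq n] {S : ℝ → Matrix n n ℂ} {S' : Matrix n n ℂ}
    (hS : HasDerivAt S S' x) (hx : IsUnit (S x)) :
    HasDerivAt (fun t => (S t)⁻¹) (-((S x)⁻¹ * S' * (S x)⁻¹)) x := by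
  simp only [Matrix.nonsing_inv_eq_ringInverse]
  exact @HasDerivAt.ringInverse x (Matrix n n ℂ) Matrix.linftyOpNormedRing
    Matrix.linftyOpNormedAlgebra (inferInstanceAs (CompleteSpace (Matrix n n ℂ))) S S' hS hx

end MatrixDeriv

/-- The algebraic identity behind the Darboux transformation: `A * S - S * B = P * R` turns the
derivative of `1 - R * S⁻¹ * (A - z)⁻¹ * P` into a commutator-type expression. -/
theorem darboux_deriv {n m : Type*} [Fintype n] [DecidableEq n] [Fintype m] [DecidableEq m]
    {A B S : Matrix n n ℂ} {P : Matrix n m ℂ} {R : Matrix m n ℂ} {Q₀ Q₁ F : Matrix m m ℂ} {z : ℂ}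
    (hident : A * S - S * B = P * R) (hS : IsUnit S) (hA : IsUnit (A - z • 1))
    (hF : Q₀ = -F - z • Q₁) :
    -((((-(Q₁ * R * B) - Q₀ * R) * S⁻¹ + R * -(S⁻¹ * (P * Q₁ * R) * S⁻¹)) * (A - z • 1)⁻¹
        + R * S⁻¹ * (0 : Matrix n n ℂ)) * P + R * S⁻¹ * (A - z • 1)⁻¹ * (A * P * Q₁ + P * Q₀)) =
      (F + Q₁ * (R * S⁻¹ * P) - R * S⁻¹ * P * Q₁) * (1 - R * S⁻¹ * (A - z • 1)⁻¹ * P)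
        - (1 - R * S⁻¹ * (A - z • 1)⁻¹ * P) * F := by
  have hdS : IsUnit S.det := (Matrix.isUnit_iff_isUnit_det S).1 hS
  have hdA : IsUnit (A - z • 1).det := (Matrix.isUnit_iff_isUnit_det _).1 hA
  have hB : B * S⁻¹ = S⁻¹ * A - S⁻¹ * (P * (R * S⁻¹)) := by
    have h : B = S⁻¹ * (A * S - P * R) := by
      rw [← hident, sub_sub_cancel, Matrix.nonsing_inv_mul_cancel_left _ _ hdS]
    rw [h]
    simp only [Matrix.mul_sub, Matrix.sub_mul, Matrix.mul_assoc, Matrix.mul_nonsing_inv _ hdS,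
      Matrix.mul_one]
  set T := (A - z • 1)⁻¹ with hT
  have hAT : A * T = 1 + z • T := by
    have h := Matrix.mul_nonsing_inv _ hdA
    rw [← hT, Matrix.sub_mul, Matrix.smul_mul, Matrix.one_mul] at h
    rw [← h, sub_add_cancel]
  have hTA : T * A = 1 + z • T := by
    have h := Matrix.nonsing_inv_mul _ hdA
    rw [← hT, Matrix.mul_sub, Matrix.mul_smul, Matrix.mul_one] at h
    rw [← h, sub_add_cancel]
  have hBT : B * (S⁻¹ * (T * P)) =
      S⁻¹ * P + z • (S⁻¹ * (T * P)) - S⁻¹ * (P * (R * (S⁻¹ * (T * P)))) := by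
    rw [← Matrix.mul_assoc, hB, Matrix.sub_mul, Matrix.mul_assoc S⁻¹ A, ← Matrix.mul_assoc A,
      hAT]
    simp only [Matrix.add_mul, Matrix.mul_add, Matrix.one_mul, Matrix.smul_mul, Matrix.mul_smul,
      Matrix.mul_assoc]
  have hTAP : T * (A * (P * Q₁)) = P * Q₁ + z • (T * (P * Q₁)) := by
    rw [← Matrix.mul_assoc, hTA, Matrix.add_mul, Matrix.one_mul, Matrix.smul_mul]
  subst hF
  simp only [Matrix.mul_add, Matrix.add_mul, Matrix.mul_sub, Matrix.sub_mul, Matrix.mul_neg,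
    Matrix.neg_mul, Matrix.mul_assoc, Matrix.mul_zero, Matrix.zero_mul, Matrix.mul_one,
    Matrix.one_mul, Matrix.smul_mul, Matrix.mul_smul, hBT, hTAP]
  abel

/-- **GBDT for Shin-Zettl systems.**  If `y` satisfies the Shin-Zettl system
`y' = [[r₁, p⁻¹],[q − λω, r₂]] y` (i.e. `y' = −(λQ₁ + Q₀)y` with `Q₁ = [[0,0],[ω,0]]`,
`Q₀ = −[[r₁, p⁻¹],[q, r₂]]`), then `ỹ = w_A y` satisfies, at the points where `S(x)` and
`A₁ − λI` are invertible, the transformed Shin-Zettl system with coefficients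
`r̃₁ = r₁ − ωX₁₂`, `r̃₂ = r₂ + ωX₁₂`, `q̃ = q + ω(X₁₁ − X₂₂)`, and unchanged `ω`, `p⁻¹`,
where `X = Π₂* S⁻¹ Π₁`. -/
theorem gbdt_shin_zettl
    (n : ℕ) (ℓ : ℝ) (lam : ℂ)
    (r₁ r₂ pinv q ω : ℝ → ℂ)
    (Q₁ Q₀ : ℝ → Matrix (Fin 2) (Fin 2) ℂ)
    (hQ₁ : Q₁ = fun x => !![0, 0; ω x, 0])
    (hQ₀ : Q₀ = fun x => -(!![r₁ x, pinv x; q x, r₂ x]))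
    (A₁ A₂ : Matrix (Fin n) (Fin n) ℂ)
    (Pi1 Pi2 : ℝ → Matrix (Fin n) (Fin 2) ℂ)
    (S : ℝ → Matrix (Fin n) (Fin n) ℂ)
    (hInit : A₁ * S 0 - S 0 * A₂ = Pi1 0 * (Pi2 0)ᴴ)
    (hPi1 : ∀ x ∈ Ico (0 : ℝ) ℓ,
      HasDerivAt Pi1 (A₁ * Pi1 x * Q₁ x + Pi1 x * Q₀ x) x)
    (hPi2 : ∀ x ∈ Ico (0 : ℝ) ℓ,
      HasDerivAt (fun t => (Pi2 t)ᴴ) (-(Q₁ x * (Pi2 x)ᴴ * A₂) - Q₀ x * (Pi2 x)ᴴ) x)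
    (hS : ∀ x ∈ Ico (0 : ℝ) ℓ,
      HasDerivAt S (Pi1 x * Q₁ x * (Pi2 x)ᴴ) x)
    (wA : ℝ → Matrix (Fin 2) (Fin 2) ℂ)
    (hwA : wA = fun x => 1 - (Pi2 x)ᴴ * (S x)⁻¹ * (A₁ - lam • 1)⁻¹ * Pi1 x)
    (X : ℝ → Matrix (Fin 2) (Fin 2) ℂ)
    (hX : X = fun x => (Pi2 x)ᴴ * (S x)⁻¹ * Pi1 x)
    (y : ℝ → Fin 2 → ℂ)
    (hy : ∀ x ∈ Ico (0 : ℝ) ℓ,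
      HasDerivAt y (!![r₁ x, pinv x; q x - lam * ω x, r₂ x] *ᵥ y x) x) :
    ∀ x ∈ Ico (0 : ℝ) ℓ, IsUnit (S x) → IsUnit (A₁ - lam • 1) →
      HasDerivAt (fun t => wA t *ᵥ y t)
        (!![r₁ x - ω x * X x 0 1, pinv x;
            (q x + ω x * (X x 0 0 - X x 1 1)) - lam * ω x, r₂ x + ω x * X x 0 1] *ᵥ
          (wA x *ᵥ y x)) x := by
  intro x hx hSu hRu
  have hident : A₁ * S x - S x * A₂ = Pi1 x * (Pi2 x)ᴴ := by
    have hd : ∀ t ∈ Ico (0 : ℝ) ℓ,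
        HasDerivAt (fun t => A₁ * S t - S t * A₂ - Pi1 t * (Pi2 t)ᴴ) 0 t := by
      intro t ht
      have h := (((hasDerivAt_const t A₁).matrix_mul (hS t ht)).sub
        ((hS t ht).matrix_mul (hasDerivAt_const t A₂))).sub
        ((hPi1 t ht).matrix_mul (hPi2 t ht))
      convert! h using 1
      simp only [Matrix.add_mul, Matrix.mul_sub, Matrix.mul_neg, Matrix.mul_assoc,
        Matrix.zero_mul, Matrix.mul_zero]
      abel
    have hsub : Icc 0 x ⊆ Ico 0 ℓ := fun t ht => ⟨ht.1, ht.2.trans_lt hx.2⟩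
    have h := constant_of_has_deriv_right_zero
      (fun t ht => (hd t (hsub ht)).continuousAt.continuousWithinAt)
      (fun t ht => (hd t (hsub (Ico_subset_Icc_self ht))).hasDerivWithinAt) x
      (right_mem_Icc.2 hx.1)
    rwa [hInit, sub_self, sub_eq_zero] at h
  set F : Matrix (Fin 2) (Fin 2) ℂ := !![r₁ x, pinv x; q x - lam * ω x, r₂ x] with hF
  have hQF : Q₀ x = -F - lam • Q₁ x := by
    rw [hQ₀, hQ₁, hF]
    ext i j
    fin_cases i <;> fin_cases j <;> simp
  have hFt : !![r₁ x - ω x * X x 0 1, pinv x;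
      (q x + ω x * (X x 0 0 - X x 1 1)) - lam * ω x, r₂ x + ω x * X x 0 1]
      = F + Q₁ x * X x - X x * Q₁ x := by
    rw [hQ₁, hF]
    ext i j
    fin_cases i <;> fin_cases j <;> 
      simp [Matrix.mul_apply, Fin.sum_univ_two, -Matrix.cons_mul] <;> ring
  have hw : HasDerivAt wA ((F + Q₁ x * X x - X x * Q₁ x) * wA x - wA x * F) x := by
    have h := ((((hPi2 x hx).matrix_mul ((hS x hx).matrix_inv hSu)).matrix_mul
      (hasDerivAt_const x (A₁ - lam • 1)⁻¹)).matrix_mul (hPi1 x hx)).const_sub 1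
    simp only [hwA, hX]
    convert! h using 1
    exact (darboux_deriv hident hSu hRu hQF).symm
  rw [hFt]
  convert! hw.matrix_mulVec (hy x hx) using 1
  rw [← hF, Matrix.sub_mulVec _ (wA x * F), Matrix.mulVec_mulVec, Matrix.mulVec_mulVec,
    sub_add_cancel]
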